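/- arXiv:1906.06952 — 5 statements merged into one kernel-verified Lean document; each statement's English description precedes it below -/
import Mathlib

section
/- Let B be a generalized Boolean algebra and, for a ∈ B, let D(a) = {λ : λ a character of B with λ(a) = true}. Then for all a, b ∈ B: a ≤ b if and only if D(a) ⊆ D(b) (in particular a ↦ D(a) is injective), and moreover D(⊥) = ∅, D(a ⊓ b) = D(a) ∩ D(b), D(a ⊔ b) = D(a) ∪ D(b), and D(a \ b) = D(a) \ D(b). Thus a ↦ D(a) is an isomorphism of generalized Boolean algebras from B onto its image inside the powerset of the set of characters of B. -/
/-- A character of a generalized Boolean algebra `B`: a map `B → Bool` which is not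
identically `false` and preserves `⊥`, joins, meets and relative complements. -/
def IsGBAChar {B : Type*} [GeneralizedBooleanAlgebra B] (l : B → Bool) : Prop :=
  (∃ a : B, l a = true) ∧ l ⊥ = false ∧
  (∀ a b : B, l (a ⊔ b) = (l a || l b)) ∧
  (∀ a b : B, l (a ⊓ b) = (l a && l b)) ∧
  (∀ a b : B, l (a \ b) = (l a && !l b))

/-- `D(a)`: the set of characters of `B` taking the value `true` at `a`. -/
def Dset {B : Type*} [GeneralizedBooleanAlgebra B] (a : B) : Set (B → Bool) :=
  {l | IsGBAChar l ∧ l a = true}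

/-- The indicator function of the complement of a prime ideal is a character. -/
lemma Order.Ideal.IsPrime.isGBAChar {B : Type*} [GeneralizedBooleanAlgebra B]
    {J : Order.Ideal B} (hJ : J.IsPrime) {l : B → Bool} (hl : ∀ x, l x = true ↔ x ∉ J) :
    IsGBAChar l := by
  have inf_mem (x y : B) : x ⊓ y ∈ J ↔ x ∈ J ∨ y ∈ J :=
    ⟨hJ.mem_or_mem, fun h => h.elim (J.lower inf_le_left) (J.lower inf_le_right)⟩
  have sdiff_mem (x y : B) : x \ y ∈ J ↔ x ∈ J ∨ y ∉ J := by
    constructor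
    · intro h
      by_contra! hxy
      exact hxy.1 (J.lower le_sup_sdiff (Order.Ideal.sup_mem hxy.2 h))
    · rintro (h | h)
      · exact J.lower sdiff_le h
      · refine (hJ.mem_or_mem (x := x \ y) (y := y) ?_).resolve_right h
        rw [inf_comm, inf_sdiff_self_right]
        exact J.bot_mem
  refine ⟨?_, ?_, fun x y => ?_, fun x y => ?_, fun x y => ?_⟩
  · obtain ⟨x, hx⟩ := (Set.ne_univ_iff_exists_notMem _).1 hJ.ne_univ
    exact ⟨x, (hl x).2 hx⟩
  · rw [← Bool.not_eq_true, hl, not_not]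
    exact J.bot_mem
  · rw [Bool.eq_iff_iff, Bool.or_eq_true, hl, hl, hl, Order.Ideal.sup_mem_iff]
    tauto
  · rw [Bool.eq_iff_iff, Bool.and_eq_true, hl, hl, hl, inf_mem]
    tauto
  · rw [Bool.eq_iff_iff, Bool.and_eq_true, Bool.not_eq_true', ← Bool.not_eq_true, hl, hl, hl,
      sdiff_mem]
    tauto

/-- Characters separate `a` from `b` whenever `a ≤ b` fails. -/
lemma exists_isGBAChar_of_not_le {B : Type*} [GeneralizedBooleanAlgebra B] {a b : B}
    (hab : ¬ a ≤ b) : ∃ l : B → Bool, IsGBAChar l ∧ l a = true ∧ l b = false := by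
  classical
  have hdisj : Disjoint (Order.PFilter.principal a : Set B) (Order.Ideal.principal b) := by
    rw [Set.disjoint_left]
    exact fun x hax hxb =>
      hab ((Order.PFilter.mem_principal.1 hax).trans (Order.Ideal.mem_principal.1 hxb))
  obtain ⟨J, hJ, hbJ, haJ⟩ := DistribLattice.prime_ideal_of_disjoint_filter_ideal hdisj
  refine ⟨fun x => decide (x ∉ J), hJ.isGBAChar fun x => decide_eq_true_iff, ?_, ?_⟩
  · exact decide_eq_true
      (Set.disjoint_left.1 haJ (Order.PFilter.mem_principal.2 le_rfl))
  · exact decide_eq_false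
      (not_not.2 (hbJ (Order.Ideal.mem_principal.2 le_rfl)))

lemma Dset_subset_Dset_iff {B : Type*} [GeneralizedBooleanAlgebra B] {a b : B} :
    Dset a ⊆ Dset b ↔ a ≤ b := by
  constructor
  · intro h
    by_contra hab
    obtain ⟨l, hl, hla, hlb⟩ := exists_isGBAChar_of_not_le hab
    exact Bool.false_ne_true (hlb.symm.trans (h ⟨hl, hla⟩).2)
  · rintro hab l ⟨hl, hla⟩
    have h := hl.2.2.1 a b
    rw [sup_eq_right.2 hab, hla, Bool.true_or] at h
    exact ⟨hl, h⟩

/-- The map `a ↦ D(a)` is an isomorphism of generalized Boolean algebras onto its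
image in the powerset of the set of characters: it reflects and preserves order
(hence is injective) and sends `⊥`, meet, join and relative complement to
`∅`, intersection, union and set difference, respectively. -/
theorem Dset_isomorphism {B : Type*} [GeneralizedBooleanAlgebra B] :
    (∀ a b : B, a ≤ b ↔ Dset a ⊆ Dset b) ∧
    Function.Injective (Dset (B := B)) ∧
    Dset (⊥ : B) = (∅ : Set (B → Bool)) ∧
    (∀ a b : B, Dset (a ⊓ b) = Dset a ∩ Dset b) ∧
    (∀ a b : B, Dset (a ⊔ b) = Dset a ∪ Dset b) ∧
    (∀ a b : B, Dset (a \ b) = Dset a \ Dset b) := by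
  refine ⟨fun a b => Dset_subset_Dset_iff.symm, fun a b h => ?_, ?_, fun a b => ?_,
    fun a b => ?_, fun a b => ?_⟩
  · exact le_antisymm (Dset_subset_Dset_iff.1 h.le) (Dset_subset_Dset_iff.1 h.ge)
  · rw [Set.eq_empty_iff_forall_notMem]
    rintro l ⟨hl, hbot⟩
    exact Bool.false_ne_true (hl.2.1.symm.trans hbot)
  · ext l
    change (IsGBAChar l ∧ _) ↔ (IsGBAChar l ∧ _) ∧ (IsGBAChar l ∧ _)
    rw [← and_and_left]
    exact and_congr_right fun hl => by rw [hl.2.2.2.1, Bool.and_eq_true]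
  · ext l
    change (IsGBAChar l ∧ _) ↔ (IsGBAChar l ∧ _) ∨ (IsGBAChar l ∧ _)
    rw [← and_or_left]
    exact and_congr_right fun hl => by rw [hl.2.2.1, Bool.or_eq_true]
  · ext l
    change (IsGBAChar l ∧ _) ↔ (IsGBAChar l ∧ _) ∧ ¬ (IsGBAChar l ∧ _)
    rw [and_assoc]
    exact and_congr_right fun hl => by simp [hl, hl.2.2.2.2]
end

section
/- Let B be a generalized Boolean algebra with Stone space B̂. Then B̂ is a Hausdorff topological space, the sets D(a) for a ∈ B form a basis of its topology consisting of compact open sets, and conversely every compact open subset of B̂ is equal to D(a) for some a ∈ B. -/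
/-- The Stone space of a generalized Boolean algebra: the set of its characters. -/
def GBAChar (B : Type*) [GeneralizedBooleanAlgebra B] : Type _ :=
  {l : B → Bool // IsGBAChar l}

/-- The basic set `D(a)` in the Stone space. -/
def DS {B : Type*} [GeneralizedBooleanAlgebra B] (a : B) : Set (GBAChar B) :=
  {l | l.1 a = true}

/-- The topology of the Stone space is generated by the sets `D(a)`, `a ∈ B`. -/
instance {B : Type*} [GeneralizedBooleanAlgebra B] : TopologicalSpace (GBAChar B) :=
  TopologicalSpace.generateFrom {S | ∃ a : B, S = DS a}

theorem DS_bot {B : Type*} [GeneralizedBooleanAlgebra B] : DS (⊥ : B) = ∅ := by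
  ext l
  simp [DS, l.2.2.1]

theorem DS_sup {B : Type*} [GeneralizedBooleanAlgebra B] (a b : B) :
    DS (a ⊔ b) = DS a ∪ DS b := by
  ext l
  simp [DS, l.2.2.2.1]

theorem DS_inf {B : Type*} [GeneralizedBooleanAlgebra B] (a b : B) :
    DS (a ⊓ b) = DS a ∩ DS b := by
  ext l
  simp [DS, l.2.2.2.2.1]

theorem DS_sdiff {B : Type*} [GeneralizedBooleanAlgebra B] (a b : B) :
    DS (a \ b) = DS a \ DS b := by
  ext l
  simp [DS, l.2.2.2.2.2]

theorem DS_finset_sup {B ι : Type*} [GeneralizedBooleanAlgebra B] (s : Finset ι) (f : ι → B) :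
    DS (s.sup f) = ⋃ i ∈ s, DS (f i) := by
  classical
  induction s using Finset.induction_on with
  | empty => simp [DS_bot]
  | insert i s _ ih => simp [DS_sup, ih]

theorem isOpen_DS {B : Type*} [GeneralizedBooleanAlgebra B] (a : B) : IsOpen (DS a) :=
  TopologicalSpace.isOpen_generateFrom_of_mem ⟨a, rfl⟩

theorem isTopologicalBasis_range_DS {B : Type*} [GeneralizedBooleanAlgebra B] :
    TopologicalSpace.IsTopologicalBasis (Set.range (DS : B → Set (GBAChar B))) where
  exists_subset_inter := by
    rintro _ ⟨a, rfl⟩ _ ⟨b, rfl⟩ l hl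
    exact ⟨_, ⟨a ⊓ b, rfl⟩, by rwa [DS_inf], (DS_inf a b).subset⟩
  sUnion_eq := by
    refine Set.eq_univ_of_forall fun l => ?_
    obtain ⟨a, ha⟩ := l.2.1
    exact ⟨DS a, ⟨a, rfl⟩, ha⟩
  eq_generateFrom := by
    have h : Set.range (DS : B → Set (GBAChar B)) = {S | ∃ a : B, S = DS a} :=
      Set.ext fun S => exists_congr fun a => eq_comm
    rw [h]
    rfl

open Classical in
/-- An ultrafilter containing some basic set `DS a` determines a character. -/
theorem isGBAChar_of_ultrafilter {B : Type*} [GeneralizedBooleanAlgebra B]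
    (F : Ultrafilter (GBAChar B)) {a : B} (ha : DS a ∈ F) :
    IsGBAChar fun b : B => decide (DS b ∈ F) := by
  refine ⟨⟨a, by simpa using ha⟩, ?_, fun b c => ?_, fun b c => ?_, fun b c => ?_⟩
  · simp [DS_bot]
  · simp [DS_sup, Ultrafilter.union_mem_iff]
  · simp [DS_inf, Filter.inter_mem_iff, ← Ultrafilter.mem_coe]
  · beta_reduce
    rw [DS_sdiff, Set.sdiff_eq, ← Ultrafilter.mem_coe, Filter.inter_mem_iff]
    simp [Ultrafilter.mem_coe, Ultrafilter.compl_mem_iff_notMem]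

theorem isCompact_DS {B : Type*} [GeneralizedBooleanAlgebra B] (a : B) :
    IsCompact (DS a) := by
  classical
  refine isCompact_iff_ultrafilter_le_nhds'.2 fun F ha => ?_
  let l : GBAChar B := ⟨_, isGBAChar_of_ultrafilter F ha⟩
  have hl (b : B) : l ∈ DS b ↔ DS b ∈ F := decide_eq_true_iff
  refine ⟨l, (hl a).2 ha, Filter.tendsto_id'.1 (TopologicalSpace.tendsto_nhds_generateFrom_iff.2 ?_)⟩
  rintro _ ⟨b, rfl⟩ hb
  exact (hl b).1 hb

theorem exists_eq_DS_of_isCompact_of_isOpen {B : Type*} [GeneralizedBooleanAlgebra B]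
    {U : Set (GBAChar B)} (hc : IsCompact U) (ho : IsOpen U) : ∃ a : B, U = DS a := by
  obtain ⟨s, hs, rfl⟩ := eq_finite_iUnion_of_isTopologicalBasis_of_isCompact_open _
    isTopologicalBasis_range_DS U hc ho
  exact ⟨hs.toFinset.sup id, by simp [DS_finset_sup]⟩

theorem exists_disjoint_DS {B : Type*} [GeneralizedBooleanAlgebra B] {l m : GBAChar B}
    (h : l ≠ m) : ∃ a b : B, l ∈ DS a ∧ m ∈ DS b ∧ Disjoint (DS a) (DS b) := by
  obtain ⟨a, ha⟩ : ∃ a, l.1 a ≠ m.1 a := Function.ne_iff.1 (Subtype.coe_ne_coe.2 h)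
  by_cases hl : l ∈ DS a
  · obtain ⟨b, hb⟩ := m.2.1
    have hm : m ∉ DS a := fun hm => ha (Eq.trans hl (Eq.symm hm))
    exact ⟨a, b \ a, hl, by rw [DS_sdiff]; exact ⟨hb, hm⟩,
      by rw [DS_sdiff]; exact Set.disjoint_sdiff_right⟩
  · obtain ⟨b, hb⟩ := l.2.1
    have hm : m ∈ DS a := by
      simp only [DS, Set.mem_ofPred_eq] at hl ⊢
      grind
    exact ⟨b \ a, a, by rw [DS_sdiff]; exact ⟨hb, hl⟩, hm,
      by rw [DS_sdiff]; exact Set.disjoint_sdiff_left⟩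

/-- The Stone space of a generalized Boolean algebra is Hausdorff, the sets `D(a)`
form a basis of its topology consisting of compact open sets, and every compact
open subset is of the form `D(a)`. -/
theorem stone_space_properties {B : Type*} [GeneralizedBooleanAlgebra B] :
    T2Space (GBAChar B) ∧
    TopologicalSpace.IsTopologicalBasis {S : Set (GBAChar B) | ∃ a : B, S = DS a} ∧
    (∀ a : B, IsCompact (DS a) ∧ IsOpen (DS a)) ∧
    (∀ U : Set (GBAChar B), IsCompact U → IsOpen U → ∃ a : B, U = DS a) := by
  refine ⟨⟨fun l m h => ?_⟩, ?_, fun a => ⟨isCompact_DS a, isOpen_DS a⟩,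
    fun U hc ho => exists_eq_DS_of_isCompact_of_isOpen hc ho⟩
  · obtain ⟨a, b, ha, hb, hab⟩ := exists_disjoint_DS h
    exact ⟨DS a, DS b, isOpen_DS a, isOpen_DS b, ha, hb, hab⟩
  · simpa only [Set.range, eq_comm] using isTopologicalBasis_range_DS (B := B)
end

section
/- For every nonzero r ∈ R there exists a character λ of B with r ∉ I_λ; equivalently, the intersection of the ideals I_λ over all characters λ of B is the zero ideal. -/
/-- `B` is a set of central idempotents of the (possibly non-unital, non-commutative)
ring `R` containing `0`, closed under the generalized Boolean algebra operations
`e ⊓ f = e*f`, `e ⊔ f = e + f - e*f`, `e \ f = e - e*f`, and forming a set of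
local units for `R`. -/
structure CentralUnits (R : Type*) [NonUnitalRing R] (B : Set R) : Prop where
  zero_mem : (0 : R) ∈ B
  idem : ∀ e ∈ B, e * e = e
  central : ∀ e ∈ B, ∀ r : R, e * r = r * e
  inf_mem : ∀ e ∈ B, ∀ f ∈ B, e * f ∈ B
  sup_mem : ∀ e ∈ B, ∀ f ∈ B, e + f - e * f ∈ B
  sdiff_mem : ∀ e ∈ B, ∀ f ∈ B, e - e * f ∈ B
  localUnits : ∀ r : R, ∃ e ∈ B, e * r = r ∧ r * e = r

/-- A character of the generalized Boolean algebra `B` (of central idempotents of `R`,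
with `e ⊓ f = e*f`, `e ⊔ f = e + f - e*f`, `e \ f = e - e*f` and `⊥ = 0`): a
`Bool`-valued map, not identically `false` on `B`, preserving `⊥`, joins, meets and
relative complements of elements of `B`. -/
def IsBChar {R : Type*} [NonUnitalRing R] (B : Set R) (l : R → Bool) : Prop :=
  (∃ e ∈ B, l e = true) ∧ l 0 = false ∧
  (∀ e ∈ B, ∀ f ∈ B, l (e + f - e * f) = (l e || l f)) ∧
  (∀ e ∈ B, ∀ f ∈ B, l (e * f) = (l e && l f)) ∧
  (∀ e ∈ B, ∀ f ∈ B, l (e - e * f) = (l e && !l f))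

/-- The set `I_λ = {r ∈ R : e * r = 0 for some e ∈ B with λ(e) = true}`. -/
def Ilam {R : Type*} [NonUnitalRing R] (B : Set R) (l : R → Bool) : Set R :=
  {r | ∃ e ∈ B, l e = true ∧ e * r = 0}

namespace CentralUnits

variable {R : Type*} [NonUnitalRing R] {B : Set R}

theorem left_comm (hB : CentralUnits R B) {e : R} (he : e ∈ B) (f x : R) :
    f * (e * x) = e * (f * x) := by
  rw [← mul_assoc, ← hB.central e he, mul_assoc]

/-- A multiplicatively closed subset of `B` none of whose elements annihilates `r`. -/
structure IsNonAnnihilating (B : Set R) (r : R) (S : Set R) : Prop where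
  subset : S ⊆ B
  mul_mem : ∀ e ∈ S, ∀ f ∈ S, e * f ∈ S
  mul_ne_zero : ∀ e ∈ S, e * r ≠ 0

theorem exists_maximal_isNonAnnihilating (hB : CentralUnits R B) {r : R} (hr : r ≠ 0) :
    ∃ U : Set R, U.Nonempty ∧ Maximal (IsNonAnnihilating B r) U := by
  obtain ⟨e, he, her, -⟩ := hB.localUnits r
  have hsingle : IsNonAnnihilating B r {e} := by
    refine ⟨by simpa using he, ?_, ?_⟩
    · rintro _ rfl _ rfl
      exact hB.idem _ he
    · rintro _ rfl
      rwa [her]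
  have hchains : ∀ c ⊆ {S | IsNonAnnihilating B r S}, IsChain (· ⊆ ·) c → c.Nonempty →
      ∃ ub ∈ {S | IsNonAnnihilating B r S}, ∀ s ∈ c, s ⊆ ub := by
    refine fun c hc hchain _ => ⟨⋃₀ c, ⟨Set.sUnion_subset fun s hs => (hc hs).subset, ?_, ?_⟩,
      fun s hs => Set.subset_sUnion_of_mem hs⟩
    · rintro x ⟨s, hs, hx⟩ y ⟨t, ht, hy⟩
      rcases hchain.total hs ht with h | h
      · exact ⟨t, ht, (hc ht).mul_mem _ (h hx) _ hy⟩
      · exact ⟨s, hs, (hc hs).mul_mem _ hx _ (h hy)⟩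
    · rintro x ⟨s, hs, hx⟩
      exact (hc hs).mul_ne_zero x hx
  obtain ⟨U, hU, hmax⟩ := zorn_subset_nonempty _ hchains {e} hsingle
  exact ⟨U, ⟨e, hU rfl⟩, hmax⟩

theorem exists_mul_eq_zero_of_notMem (hB : CentralUnits R B) {r : R} {U : Set R}
    (hne : U.Nonempty) (hU : Maximal (IsNonAnnihilating B r) U) {e : R} (he : e ∈ B)
    (heU : e ∉ U) : ∃ u ∈ U, u * (e * r) = 0 := by
  by_contra! hcon
  let V : Set R := {x | x ∈ B ∧ ∃ u ∈ U, x * (u * e) = u * e}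
  have hV : IsNonAnnihilating B r V := by
    refine ⟨fun x hx => hx.1, ?_, ?_⟩
    · rintro x ⟨hx, u, hu, hxu⟩ y ⟨hy, v, hv, hyv⟩
      refine ⟨hB.inf_mem x hx y hy, u * v, hU.prop.mul_mem u hu v hv, ?_⟩
      have huB := hU.prop.subset hu
      have hvB := hU.prop.subset hv
      rw [mul_assoc x, mul_assoc u, hB.left_comm huB y, hyv, hB.left_comm hvB u,
        hB.left_comm hvB x, hxu]
    · rintro x ⟨hx, u, hu, hxu⟩ hxr
      apply hcon u hu
      rw [← mul_assoc, ← hxu, hB.central x hx, mul_assoc, hxr, mul_zero]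
  have hUV : U ⊆ V := fun x hx => ⟨hU.prop.subset hx, x, hx, by
    rw [← mul_assoc, hB.idem x (hU.prop.subset hx)]⟩
  obtain ⟨u, hu⟩ := hne
  exact heU (hU.le_of_ge hV hUV ⟨he, u, hu, by
    rw [← hB.left_comm he, hB.idem e he]⟩)

theorem mem_of_mul_eq (hB : CentralUnits R B) {r : R} {U : Set R}
    (hne : U.Nonempty) (hU : Maximal (IsNonAnnihilating B r) U) {e x : R} (he : e ∈ B)
    (hx : x ∈ U) (hex : e * x = x) : e ∈ U := by
  by_contra heU
  obtain ⟨u, hu, h⟩ := hB.exists_mul_eq_zero_of_notMem hne hU he heU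
  apply hU.prop.mul_ne_zero _ (hU.prop.mul_mem u hu x hx)
  rw [← hex, hB.central e he, mul_assoc, mul_assoc, hB.left_comm (hU.prop.subset hx), h, mul_zero]

open Classical in
theorem isBChar_decide_mem (hB : CentralUnits R B) {r : R} {U : Set R}
    (hne : U.Nonempty) (hU : Maximal (IsNonAnnihilating B r) U) :
    IsBChar B (fun x => decide (x ∈ U)) := by
  have hzero : (0 : R) ∉ U := fun h => hU.prop.mul_ne_zero 0 h (zero_mul r)
  have hmul : ∀ e ∈ B, ∀ f ∈ B, (e * f ∈ U ↔ e ∈ U ∧ f ∈ U) := by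
    refine fun e he f hf => ⟨fun h => ⟨?_, ?_⟩, fun h => hU.prop.mul_mem e h.1 f h.2⟩
    · exact hB.mem_of_mul_eq hne hU he h (by rw [← mul_assoc, hB.idem e he])
    · exact hB.mem_of_mul_eq hne hU hf h (by rw [hB.left_comm he, hB.idem f hf])
  refine ⟨?_, by simpa using hzero, fun e he f hf => ?_, fun e he f hf => ?_, fun e he f hf => ?_⟩
  · obtain ⟨u, hu⟩ := hne
    exact ⟨u, hU.prop.subset hu, by simpa using hu⟩
  · have key : e + f - e * f ∈ U ↔ e ∈ U ∨ f ∈ U := by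
      have hs := hB.sup_mem e he f hf
      refine ⟨fun h => ?_, ?_⟩
      · by_contra! hef
        obtain ⟨u, hu, hue⟩ := hB.exists_mul_eq_zero_of_notMem hne hU he hef.1
        obtain ⟨v, hv, hvf⟩ := hB.exists_mul_eq_zero_of_notMem hne hU hf hef.2
        have huB := hU.prop.subset hu
        apply hU.prop.mul_ne_zero _ (hU.prop.mul_mem _ (hU.prop.mul_mem u hu v hv) _ h)
        have h1 : u * (v * (e * r)) = 0 := by rw [hB.left_comm (hU.prop.subset hv), hue, mul_zero]
        have h2 : u * (v * (f * r)) = 0 := by rw [hvf, mul_zero]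
        have h3 : u * (v * (e * (f * r))) = 0 := by
          rw [hB.left_comm he, hvf, mul_zero, mul_zero]
        simp only [mul_assoc, sub_mul, add_mul, mul_sub, mul_add, h1, h2, h3, add_zero, sub_zero]
      · rintro (h | h)
        · refine hB.mem_of_mul_eq hne hU hs h ?_
          rw [hB.central _ hs, mul_sub, mul_add, ← mul_assoc, hB.idem e he, add_sub_cancel_right]
        · refine hB.mem_of_mul_eq hne hU hs h ?_
          rw [sub_mul, add_mul, mul_assoc, hB.idem f hf, add_sub_cancel_left]
    rw [Bool.eq_iff_iff]
    simpa using key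
  · rw [Bool.eq_iff_iff]
    simpa using hmul e he f hf
  · have key : e - e * f ∈ U ↔ e ∈ U ∧ f ∉ U := by
      refine ⟨fun h => ⟨?_, fun hfU => ?_⟩, fun ⟨heU, hfU⟩ => ?_⟩
      · exact hB.mem_of_mul_eq hne hU he h (by rw [mul_sub, ← mul_assoc, hB.idem e he])
      · refine hzero ?_
        have := hU.prop.mul_mem _ h f hfU
        rwa [sub_mul, mul_assoc, hB.idem f hf, sub_self] at this
      · by_contra hg
        obtain ⟨u, hu, huf⟩ := hB.exists_mul_eq_zero_of_notMem hne hU hf hfU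
        obtain ⟨v, hv, hvg⟩ := hB.exists_mul_eq_zero_of_notMem hne hU (hB.sdiff_mem e he f hf) hg
        apply hU.prop.mul_ne_zero _ (hU.prop.mul_mem _ (hU.prop.mul_mem v hv u hu) _ heU)
        have h1 : v * (e * r) = v * (e * (f * r)) := by
          rwa [sub_mul, mul_sub, sub_eq_zero, mul_assoc] at hvg
        rw [mul_assoc, mul_assoc, hB.left_comm (hU.prop.subset hu), h1,
          ← hB.left_comm (hU.prop.subset hu), hB.left_comm he, huf, mul_zero, mul_zero]
    rw [Bool.eq_iff_iff]
    simpa using key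

end CentralUnits

/-- For every nonzero `r ∈ R` there is a character `λ` of `B` with `r ∉ I_λ`;
equivalently, the intersection of the ideals `I_λ` over all characters `λ` of `B`
is the zero ideal. -/
theorem exists_char_not_mem_Ilam {R : Type*} [NonUnitalRing R] (B : Set R)
    (hB : CentralUnits R B) :
    (∀ r : R, r ≠ 0 → ∃ l : R → Bool, IsBChar B l ∧ r ∉ Ilam B l) ∧
    (∀ r : R, (∀ l : R → Bool, IsBChar B l → r ∈ Ilam B l) → r = 0) := by
  have hex : ∀ r : R, r ≠ 0 → ∃ l : R → Bool, IsBChar B l ∧ r ∉ Ilam B l := by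
    classical
    intro r hr
    obtain ⟨U, hne, hU⟩ := hB.exists_maximal_isNonAnnihilating hr
    refine ⟨fun x => decide (x ∈ U), by convert hB.isBChar_decide_mem hne hU, ?_⟩
    rintro ⟨e, -, he, her⟩
    exact hU.prop.mul_ne_zero e (of_decide_eq_true he) her
  refine ⟨hex, fun r hr => ?_⟩
  by_contra h
  obtain ⟨l, hl, hrl⟩ := hex r h
  exact hrl (hr l hl)
end

section
/- Let A be a commutative ring that has a set of idempotent local units (for every a ∈ A there is an idempotent e with ea = a), let B be the set of all idempotents of A, a generalized Boolean algebra under e ⊓ f = ef, e ⊔ f = e + f − ef, e \ f = e − ef, and let λ be a character of B. Then the quotient ring A/I_λ is an indecomposable unital commutative ring: its only idempotents are 0 and 1. -/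
/-- The set of idempotents of `A`. -/
def IdemSet (A : Type*) [Mul A] : Set A := {e | e * e = e}

/-- Let `A` be a commutative ring with a set of idempotent local units, `B` its
generalized Boolean algebra of idempotents and `λ` a character of `B`.  Then the
quotient `A/I_λ` is an indecomposable unital commutative ring: it has an identity
(the class of any `u ∈ B` with `λ(u) = true`, which is nonzero), and every
idempotent of `A/I_λ` is `0` or `1`; i.e. every `a` with `a*a ≡ a (mod I_λ)`
satisfies `a ∈ I_λ` or `a ≡ u (mod I_λ)` for some `u ∈ B` with `λ(u) = true`. -/
theorem quotient_indecomposable {A : Type*} [NonUnitalCommRing A]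
    (hlu : ∀ a : A, ∃ e : A, e * e = e ∧ e * a = a)
    (l : A → Bool) (hl : IsBChar (IdemSet A) l) :
    (∃ u : A, u * u = u ∧ l u = true ∧ (∀ a : A, u * a - a ∈ Ilam (IdemSet A) l) ∧
      u ∉ Ilam (IdemSet A) l) ∧
    (∀ a : A, a * a - a ∈ Ilam (IdemSet A) l →
      a ∈ Ilam (IdemSet A) l ∨
        ∃ u : A, u * u = u ∧ l u = true ∧ a - u ∈ Ilam (IdemSet A) l) := by
  obtain ⟨⟨u, hu, hlu'⟩, h0, -, hmul, hdiff⟩ := hl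
  have huu : u * u = u := hu
  refine ⟨⟨u, huu, hlu', fun a => ⟨u, hu, hlu', ?_⟩, ?_⟩, ?_⟩
  · rw [mul_sub, ← mul_assoc, huu, sub_self]
  · rintro ⟨e, he, hle, heu⟩
    have h := hmul e he u hu
    rw [heu, h0, hle, hlu'] at h
    simp at h
  · rintro a ⟨e, he, hle, hea⟩
    have hee : e * e = e := he
    have heaa : e * (a * a) = e * a := by rwa [mul_sub, sub_eq_zero] at hea
    have hf : e * a * (e * a) = e * a := by rw [mul_mul_mul_comm, hee, heaa]
    have hef : e * (e * a) = e * a := by rw [← mul_assoc, hee]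
    have hfa : e * a * a = e * a := by rw [mul_assoc, heaa]
    cases hlf : l (e * a) with
    | true =>
      refine Or.inr ⟨e * a, hf, hlf, e * a, hf, hlf, ?_⟩
      rw [mul_sub, hfa, hf, sub_self]
    | false =>
      have hg := hdiff e he (e * a) hf
      rw [hef, hle, hlf] at hg
      refine Or.inl ⟨e - e * a, ?_, hg, ?_⟩
      · change (e - e * a) * (e - e * a) = e - e * a
        rw [mul_sub, sub_mul, sub_mul, hf, hee, mul_comm (e * a) e, hef, sub_self, sub_zero]
      · rw [sub_mul, hfa, sub_self]
end

section
/- Let S be an inverse semigroup with a spectral action α on a ring A, let E(Z(A)) denote the set of central idempotents of A, a generalized Boolean algebra under e ⊓ f = ef, e ⊔ f = e + f − ef, e \ f = e − ef, and for s ∈ S let D̂_s = {λ : λ a character of E(Z(A)) with λ(1_{ss*}) = true}. Then for every s ∈ S and every λ ∈ D̂_{s*}, the map α̂_s(λ) : E(Z(A)) → Bool defined by α̂_s(λ)(e) = λ(α_{s*}(e·1_{ss*})) is a character of E(Z(A)), and α̂_s(λ) ∈ D̂_s. -/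
/-- An inverse semigroup: a semigroup with an involution `s ↦ s*` such that
`s s* s = s`, `s* s s* = s*`, and all idempotents commute. -/
class InverseSemigroup (S : Type*) extends Semigroup S where
  star : S → S
  star_star : ∀ s : S, star (star s) = s
  mul_star_mul : ∀ s : S, s * star s * s = s
  star_mul_star : ∀ s : S, star s * s * star s = star s
  idem_comm : ∀ e f : S, e * e = e → f * f = f → e * f = f * e

open InverseSemigroup

/-- A spectral action of an inverse semigroup `S` on a ring `A`: a homomorphism of
inverse semigroups `s ↦ α_s : D_{s*} → D_s` from `S` into the inverse semigroup of
ring isomorphisms between two-sided ideals of `A`, which is non-degenerate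
(`A = Σ_{e ∈ E(S)} D_e`) and such that each `D_e`, `e ∈ E(S)`, is unital with
identity `1_e` (the field `unit`). -/
structure SpectralAction (S : Type*) [InverseSemigroup S] (A : Type*)
    [NonUnitalRing A] where
  /-- The two-sided ideal `D_s`. -/
  D : S → Set A
  /-- The partial isomorphism `α_s : D_{s*} → D_s` (as a total map on `A`; only its
  values on `D_{s*}` are constrained). -/
  map : S → A → A
  /-- The identity `1_e` of the unital ideal `D_e`, for idempotent `e`. -/
  unit : S → A
  zero_mem : ∀ s : S, (0 : A) ∈ D s
  add_mem : ∀ s : S, ∀ a ∈ D s, ∀ b ∈ D s, a + b ∈ D s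
  neg_mem : ∀ s : S, ∀ a ∈ D s, -a ∈ D s
  ideal_left : ∀ s : S, ∀ a ∈ D s, ∀ r : A, r * a ∈ D s
  ideal_right : ∀ s : S, ∀ a ∈ D s, ∀ r : A, a * r ∈ D s
  map_mem : ∀ s : S, ∀ a ∈ D (star s), map s a ∈ D s
  map_inv : ∀ s : S, ∀ a ∈ D (star s), map (star s) (map s a) = a
  map_add : ∀ s : S, ∀ a ∈ D (star s), ∀ b ∈ D (star s),
    map s (a + b) = map s a + map s b
  map_mul : ∀ s : S, ∀ a ∈ D (star s), ∀ b ∈ D (star s),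
    map s (a * b) = map s a * map s b
  /-- `α_{st} = α_s ∘ α_t` as partial isomorphisms: equality of domains … -/
  dom_comp : ∀ s t : S, ∀ a : A,
    a ∈ D (star (s * t)) ↔ a ∈ D (star t) ∧ map t a ∈ D (star s)
  /-- … and equality of values. -/
  map_comp : ∀ s t : S, ∀ a ∈ D (star (s * t)), map (s * t) a = map s (map t a)
  unit_mem : ∀ e : S, e * e = e → unit e ∈ D e
  unit_left : ∀ e : S, e * e = e → ∀ a ∈ D e, unit e * a = a
  unit_right : ∀ e : S, e * e = e → ∀ a ∈ D e, a * unit e = a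
  /-- Non-degeneracy: `A = Σ_{e ∈ E(S)} D_e`. -/
  nondegenerate : ∀ a : A,
    a ∈ AddSubgroup.closure (⋃ e ∈ {e : S | e * e = e}, D e)

variable {S : Type*} [InverseSemigroup S] {A : Type*} [NonUnitalRing A]

/-- The generalized Boolean algebra `E(Z(A))` of central idempotents of `A`
(with `e ⊓ f = ef`, `e ⊔ f = e + f - ef`, `e \\ f = e - ef`, `⊥ = 0`). -/
def EZ (A : Type*) [NonUnitalRing A] : Set A :=
  {e | e * e = e ∧ ∀ r : A, e * r = r * e}

/-- The map `α̂_s(λ)(e) = λ(α_{s*}(e·1_{ss*}))` on characters of `E(Z(A))`. -/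
def hatAlpha (act : SpectralAction S A) (s : S) (l : A → Bool) : A → Bool :=
  fun e => l (act.map (star s) (e * act.unit (s * star s)))

theorem InverseSemigroup.star_eq_self_of_idem (e : S) (he : e * e = e) :
    InverseSemigroup.star e = e := by
  have h1 : e * InverseSemigroup.star e * e = e := mul_star_mul e
  have h2 : InverseSemigroup.star e * e * InverseSemigroup.star e = InverseSemigroup.star e :=
    star_mul_star e
  generalize InverseSemigroup.star e = f at h1 h2
  have hfe : (f * e) * (f * e) = f * e := by rw [← mul_assoc, h2]
  have hef : (e * f) * (e * f) = e * f := by rw [← mul_assoc, h1]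
  have hf : (f * e) * (e * f) = f := by
    rw [mul_assoc, ← mul_assoc e e f, he, ← mul_assoc, h2]
  have hc := idem_comm _ _ hfe hef
  have hff : f * f = f := by
    calc f * f = ((f * e) * (e * f)) * ((f * e) * (e * f)) := by rw [hf]
      _ = ((f * e) * (e * f)) * ((e * f) * (f * e)) := by rw [hc]
      _ = (f * e) * ((e * f) * (e * f)) * (f * e) := by simp only [mul_assoc]
      _ = (f * e) * ((e * f) * (f * e)) := by rw [hef, mul_assoc]
      _ = (f * e) * ((f * e) * (e * f)) := by rw [hc]
      _ = ((f * e) * (f * e)) * (e * f) := by rw [mul_assoc (f * e) (f * e)]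
      _ = f := by rw [hfe, hf]
  have hcomm := idem_comm e f he hff
  calc f = f * e * f := h2.symm
    _ = e * f := by rw [← hcomm, mul_assoc, hff]
    _ = e * f * e := by rw [mul_assoc, ← hcomm, ← mul_assoc, he]
    _ = e := h1

theorem InverseSemigroup.mul_star_idem (s : S) :
    (s * InverseSemigroup.star s) * (s * InverseSemigroup.star s) =
      s * InverseSemigroup.star s := by
  rw [← mul_assoc, mul_star_mul]

namespace SpectralAction

variable (act : SpectralAction S A)

theorem mem_D_mul_star (s : S) (a : A) :
    a ∈ act.D (s * InverseSemigroup.star s) ↔ a ∈ act.D s := by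
  have h := act.dom_comp s (InverseSemigroup.star s) a
  rw [star_eq_self_of_idem _ (mul_star_idem s), InverseSemigroup.star_star] at h
  rw [h]
  refine ⟨And.left, fun ha => ⟨ha, act.map_mem _ _ ?_⟩⟩
  rwa [InverseSemigroup.star_star]

theorem unit_mem_D (s : S) : act.unit (s * InverseSemigroup.star s) ∈ act.D s :=
  (act.mem_D_mul_star s _).1 (act.unit_mem _ (mul_star_idem s))

theorem unit_mul_of_mem (s : S) {a : A} (ha : a ∈ act.D s) :
    act.unit (s * InverseSemigroup.star s) * a = a :=
  act.unit_left _ (mul_star_idem s) a ((act.mem_D_mul_star s a).2 ha)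

theorem mul_unit_of_mem (s : S) {a : A} (ha : a ∈ act.D s) :
    a * act.unit (s * InverseSemigroup.star s) = a :=
  act.unit_right _ (mul_star_idem s) a ((act.mem_D_mul_star s a).2 ha)

theorem unit_comm (s : S) (r : A) :
    act.unit (s * InverseSemigroup.star s) * r = r * act.unit (s * InverseSemigroup.star s) := by
  have h1 := act.unit_mul_of_mem s (act.ideal_left s _ (act.unit_mem_D s) r)
  have h2 := act.mul_unit_of_mem s (act.ideal_right s _ (act.unit_mem_D s) r)
  rw [← h2, mul_assoc, h1]

theorem unit_mem_EZ (s : S) : act.unit (s * InverseSemigroup.star s) ∈ EZ A :=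
  ⟨act.unit_mul_of_mem s (act.unit_mem_D s), act.unit_comm s⟩

theorem map_mem_EZ (s : S) {x : A} (hx : x ∈ EZ A) (hxs : x ∈ act.D (InverseSemigroup.star s)) :
    act.map s x ∈ EZ A := by
  have hy := act.map_mem s x hxs
  refine ⟨by rw [← act.map_mul s x hxs x hxs, hx.1], fun r => ?_⟩
  have hcomm : ∀ b ∈ act.D s, act.map s x * b = b * act.map s x := by
    intro b hb
    have hb' : b ∈ act.D (InverseSemigroup.star (InverseSemigroup.star s)) := by
      rwa [InverseSemigroup.star_star]
    have hc := act.map_mem (InverseSemigroup.star s) b hb'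
    have hinv := act.map_inv (InverseSemigroup.star s) b hb'
    rw [InverseSemigroup.star_star] at hinv
    rw [← hinv, ← act.map_mul s x hxs _ hc, ← act.map_mul s _ hc x hxs, hx.2]
  calc act.map s x * r
      = act.map s x * (act.unit (s * InverseSemigroup.star s) * r) := by
        rw [← mul_assoc, act.mul_unit_of_mem s hy]
    _ = act.unit (s * InverseSemigroup.star s) * r * act.map s x :=
        hcomm _ (act.ideal_right s _ (act.unit_mem_D s) r)
    _ = r * act.map s x := by
        rw [act.unit_comm, mul_assoc, act.unit_mul_of_mem s hy]

theorem map_star_unit (s : S) :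
    act.map (InverseSemigroup.star s) (act.unit (s * InverseSemigroup.star s)) =
      act.unit (InverseSemigroup.star s * s) := by
  have hu : act.unit (s * InverseSemigroup.star s) ∈
      act.D (InverseSemigroup.star (InverseSemigroup.star s)) := by
    rw [InverseSemigroup.star_star]; exact act.unit_mem_D s
  have hv := act.unit_mem_D (InverseSemigroup.star s)
  have hmem := act.map_mem _ _ hu
  have hw := act.map_mem s _ hv
  have h1 := act.mul_unit_of_mem _ hmem
  have h2 := act.map_inv s _ hv
  rw [InverseSemigroup.star_star] at h1 h2 hv hw
  have hw' : act.map s (act.unit (InverseSemigroup.star s * s)) ∈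
      act.D (InverseSemigroup.star (InverseSemigroup.star s)) := by
    rwa [InverseSemigroup.star_star]
  rw [← h1]
  nth_rewrite 1 [← h2]
  rw [← act.map_mul _ _ hu _ hw', act.unit_mul_of_mem s hw, h2]

theorem map_sub (s : S) {a b : A} (ha : a ∈ act.D (InverseSemigroup.star s))
    (hb : b ∈ act.D (InverseSemigroup.star s)) :
    act.map s (a - b) = act.map s a - act.map s b := by
  have hab : a - b ∈ act.D (InverseSemigroup.star s) := by
    rw [sub_eq_add_neg]; exact act.add_mem _ _ ha _ (act.neg_mem _ _ hb)
  rw [eq_sub_iff_add_eq, ← act.map_add s _ hab _ hb, sub_add_cancel]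

theorem map_zero (s : S) : act.map s 0 = 0 := by
  simpa using act.map_sub s (act.zero_mem _) (act.zero_mem _)

end SpectralAction

/-- For every `s ∈ S` and every character `λ` of `E(Z(A))` with `λ(1_{s*s}) = true`
(i.e. `λ ∈ D̂_{s*}`), the map `α̂_s(λ) : e ↦ λ(α_{s*}(e·1_{ss*}))` is a character of
`E(Z(A))` and lies in `D̂_s`, i.e. takes the value `true` at `1_{ss*}`. -/
theorem hatAlpha_is_char (act : SpectralAction S A) (s : S) (l : A → Bool)
    (hl : IsBChar (EZ A) l)
    (hls : l (act.unit (InverseSemigroup.star s * s)) = true) :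
    IsBChar (EZ A) (hatAlpha act s l) ∧
    hatAlpha act s l (act.unit (s * InverseSemigroup.star s)) = true := by
  have hD : ∀ e : A, e * act.unit (s * InverseSemigroup.star s) ∈
      act.D (InverseSemigroup.star (InverseSemigroup.star s)) := by
    intro e
    rw [InverseSemigroup.star_star]
    exact act.ideal_left s _ (act.unit_mem_D s) e
  have hu := act.unit_mem_EZ s
  have hEZ : ∀ e ∈ EZ A, act.map (InverseSemigroup.star s)
      (e * act.unit (s * InverseSemigroup.star s)) ∈ EZ A := by
    refine fun e he => act.map_mem_EZ _ ⟨?_, fun r => ?_⟩ (hD e)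
    · rw [mul_assoc, ← mul_assoc _ e, hu.2 e, mul_assoc e, hu.1, ← mul_assoc, he.1]
    · rw [mul_assoc, hu.2, ← mul_assoc, he.2, mul_assoc]
  have hmul : ∀ e f : A, act.map (InverseSemigroup.star s)
      (e * f * act.unit (s * InverseSemigroup.star s)) =
      act.map (InverseSemigroup.star s) (e * act.unit (s * InverseSemigroup.star s)) *
      act.map (InverseSemigroup.star s) (f * act.unit (s * InverseSemigroup.star s)) := by
    intro e f
    rw [← act.map_mul _ _ (hD e) _ (hD f), mul_assoc e _ (f * _), ← mul_assoc _ f, hu.2 f,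
      mul_assoc f, hu.1, mul_assoc]
  have htrue : hatAlpha act s l (act.unit (s * InverseSemigroup.star s)) = true := by
    rw [hatAlpha, hu.1, act.map_star_unit, hls]
  obtain ⟨-, h0, hsup, hinf, hsdiff⟩ := hl
  refine ⟨⟨⟨_, hu, htrue⟩, ?_, fun e he f hf => ?_, fun e he f hf => ?_, fun e he f hf => ?_⟩,
    htrue⟩
  · rw [hatAlpha, zero_mul, act.map_zero, h0]
  · have hadd := act.add_mem _ _ (hD e) _ (hD f)
    simp only [hatAlpha]
    rw [sub_mul, add_mul, act.map_sub _ hadd (hD _), act.map_add _ _ (hD e) _ (hD f), hmul]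
    exact hsup _ (hEZ e he) _ (hEZ f hf)
  · simp only [hatAlpha]
    rw [hmul]
    exact hinf _ (hEZ e he) _ (hEZ f hf)
  · simp only [hatAlpha]
    rw [sub_mul, act.map_sub _ (hD e) (hD _), hmul]
    exact hsdiff _ (hEZ e he) _ (hEZ f hf)
end
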